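/- arXiv:1806.01149 — 2 statements merged into one kernel-verified Lean document; each statement's English description precedes it below -/
import Mathlib

section
/- The limit as n → ∞ of (∑_{k=1}^n φ(4k − 3)) / (4n)² equals 1 / π², and likewise the limit as n → ∞ of (∑_{k=1}^n φ(4k − 1)) / (4n)² equals 1 / π². -/
open Filter Finset Real

theorem sum_Ioc_sum_divisorsAntidiagonal {R : Type*} [AddCommMonoid R] (F : ℕ → ℕ → R) (N : ℕ) :
    ∑ m ∈ Ioc 0 N, ∑ x ∈ m.divisorsAntidiagonal, F x.1 x.2 =
      ∑ d ∈ Ioc 0 N, ∑ e ∈ Ioc 0 (N / d), F d e := by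
  rw [sum_sigma', sum_sigma']
  refine sum_bij' (fun x _ ↦ ⟨x.2.1, x.2.2⟩) (fun x _ ↦ ⟨x.1 * x.2, (x.1, x.2)⟩) ?_ ?_ ?_ ?_ ?_
  · rintro ⟨m, d, e⟩ h
    simp only [mem_sigma, mem_Ioc, Nat.mem_divisorsAntidiagonal] at h ⊢
    obtain ⟨⟨hm, hN⟩, rfl, -⟩ := h
    have hd := Nat.pos_of_mul_pos_right hm
    have he := Nat.pos_of_mul_pos_left hm
    exact ⟨⟨hd, (Nat.le_mul_of_pos_right d he).trans hN⟩, he,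
      (Nat.le_div_iff_mul_le hd).2 (by rwa [mul_comm])⟩
  · rintro ⟨d, e⟩ h
    simp only [mem_sigma, mem_Ioc, Nat.mem_divisorsAntidiagonal] at h ⊢
    obtain ⟨⟨hd, -⟩, he, hN⟩ := h
    have hpos := Nat.mul_pos hd he
    exact ⟨⟨hpos, by rw [mul_comm]; exact (Nat.le_div_iff_mul_le hd).1 hN⟩, trivial, hpos.ne'⟩
  · rintro ⟨m, d, e⟩ h
    simp only [mem_sigma, Nat.mem_divisorsAntidiagonal] at h
    obtain ⟨-, rfl, -⟩ := h
    rfl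
  · intros; rfl
  · intros; rfl

theorem totient_eq_sum_moebius_mul {m : ℕ} (hm : 0 < m) :
    (m.totient : ℝ) =
      ∑ x ∈ m.divisorsAntidiagonal, (ArithmeticFunction.moebius x.1 : ℝ) * (x.2 : ℝ) := by
  refine ((ArithmeticFunction.sum_eq_iff_sum_mul_moebius_eq
    (f := fun n ↦ (n.totient : ℝ)) (g := fun n ↦ (n : ℝ))).1 (fun n _ ↦ ?_) m hm).symm
  exact_mod_cast n.sum_totient

/-- The sum of the `e ≤ y` for which `d * e` lies in the residue class `a` modulo `4`. -/
def sumMulModFour (a d y : ℕ) : ℕ := ∑ e ∈ Ioc 0 y with d * e % 4 = a, e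

theorem sum_totient_mod_four_eq (a N : ℕ) :
    ∑ m ∈ Ioc 0 N with m % 4 = a, (m.totient : ℝ) =
      ∑ d ∈ Ioc 0 N, (ArithmeticFunction.moebius d : ℝ) * sumMulModFour a d (N / d) := by
  have h := sum_Ioc_sum_divisorsAntidiagonal (fun d e ↦ if d * e % 4 = a then
    (ArithmeticFunction.moebius d : ℝ) * (e : ℝ) else 0) N
  simp only [sumMulModFour, Nat.cast_sum, mul_sum, sum_filter, Nat.cast_ite, Nat.cast_zero,
    mul_ite, mul_zero]
  rw [← h]
  refine sum_congr rfl fun m hm ↦ ?_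
  rw [sum_congr rfl fun x hx ↦ by rw [(Nat.mem_divisorsAntidiagonal.1 hx).1]]
  split_ifs
  · exact totient_eq_sum_moebius_mul (mem_Ioc.1 hm).1
  · simp

theorem sumMulModFour_le (a d y : ℕ) : sumMulModFour a d y ≤ y ^ 2 := by
  calc sumMulModFour a d y ≤ ∑ e ∈ Ioc 0 y, y :=
        (sum_le_sum_of_subset (filter_subset _ _)).trans
          (sum_le_sum fun e he ↦ (mem_Ioc.1 he).2)
    _ = y ^ 2 := by simp [sq]

theorem sumMulModFour_of_even {a d : ℕ} (ha : Odd a) (hd : Even d) (y : ℕ) :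
    sumMulModFour a d y = 0 := by
  refine sum_eq_zero fun e he ↦ ?_
  have h := (mem_filter.1 he).2
  have := (Nat.even_mul (n := e)).2 (.inl hd)
  grind

theorem sumMulModFour_succ (a d y : ℕ) : sumMulModFour a d (y + 1) =
    sumMulModFour a d y + if d * (y + 1) % 4 = a then y + 1 else 0 := by
  simp only [sumMulModFour, sum_filter]
  rw [← sum_Ioc_succ_top (Nat.zero_le y)]

theorem sumMulModFour_bounds {a d : ℕ} (ha : Odd a) (ha4 : a < 4) (hd : Odd d) (y : ℕ) :
    y ^ 2 ≤ 8 * sumMulModFour a d y + (4 * y + 16) ∧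
      8 * sumMulModFour a d y ≤ y ^ 2 + (4 * y + 16) := by
  induction y using Nat.strong_induction_on with
  | _ y ih =>
    have hs := sumMulModFour_succ a d
    have h0 : sumMulModFour a d 0 = 0 := by simp [sumMulModFour]
    have hd4 : d % 4 = 1 ∨ d % 4 = 3 := by grind
    have ha' : a = 1 ∨ a = 3 := by grind
    simp only [Nat.mul_mod d] at hs
    match y with
    | 0 => simp [h0]
    | 1 => rw [hs 0, h0]; split_ifs <;> simp
    | 2 => rw [hs 1, hs 0, h0]; split_ifs <;> simp
    | 3 =>
      rw [hs 2, hs 1, hs 0, h0]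
      rcases hd4 with h | h <;> rcases ha' with rfl | rfl <;> simp [h]
    | y + 4 =>
      have := ih y (by lia)
      rw [hs (y + 3), hs (y + 2), hs (y + 1), hs y]
      have hy : y % 4 < 4 := Nat.mod_lt _ (by norm_num)
      simp only [Nat.add_mod y, add_assoc]
      generalize hr : y % 4 = r at hy
      have e : (y + 4) ^ 2 = y ^ 2 + (8 * y + 16) := by ring
      rw [e]
      generalize y ^ 2 = q at *
      rcases hd4 with h | h <;> rcases ha' with rfl | rfl <;> interval_cases r <;>
        simp [h] <;> lia

theorem tendsto_sumMulModFour_div_sq {a d : ℕ} (ha : Odd a) (ha4 : a < 4) (hd : Odd d) :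
    Tendsto (fun y : ℕ ↦ (sumMulModFour a d y : ℝ) / (y : ℝ) ^ 2) atTop (nhds (1 / 8)) := by
  have h1 : Tendsto (fun y : ℕ ↦ (1 : ℝ) / y) atTop (nhds 0) := tendsto_one_div_atTop_nhds_zero_nat
  have h2 : Tendsto (fun y : ℕ ↦ (1 / 2 : ℝ) * (1 / y) + 2 * (1 / y) ^ 2) atTop (nhds 0) := by
    simpa only [mul_zero, zero_pow two_ne_zero, add_zero] using
      (h1.const_mul (1 / 2)).add ((h1.pow 2).const_mul 2)
  rw [tendsto_iff_norm_sub_tendsto_zero]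
  refine squeeze_zero' (.of_forall fun _ ↦ norm_nonneg _) ?_ h2
  filter_upwards [eventually_gt_atTop 0] with y hy
  have hy' : (0 : ℝ) < y := by exact_mod_cast hy
  obtain ⟨hl, hu⟩ := sumMulModFour_bounds ha ha4 hd y
  have hl' : (y : ℝ) ^ 2 ≤ 8 * sumMulModFour a d y + (4 * y + 16) := by exact_mod_cast hl
  have hu' : 8 * (sumMulModFour a d y : ℝ) ≤ y ^ 2 + (4 * y + 16) := by exact_mod_cast hu
  have e : (sumMulModFour a d y : ℝ) / (y : ℝ) ^ 2 - 1 / 8 =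
      (8 * sumMulModFour a d y - y ^ 2) / (8 * y ^ 2) := by field_simp
  have e' : (1 / 2 : ℝ) * (1 / y) + 2 * (1 / y) ^ 2 = (4 * y + 16) / (8 * y ^ 2) := by
    field_simp; ring
  rw [e, e', Real.norm_eq_abs, abs_div, abs_of_pos (by positivity : (0 : ℝ) < 8 * y ^ 2)]
  gcongr
  exact abs_le.2 ⟨by linarith, by linarith⟩

theorem tendsto_natDiv_div_self {d : ℕ} :
    Tendsto (fun N : ℕ ↦ ((N / d : ℕ) : ℝ) / N) atTop (nhds (1 / d)) := by
  have := (tendsto_nat_floor_mul_div_atTop (R := ℝ) (a := 1 / d) (by positivity)).comp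
    tendsto_natCast_atTop_atTop
  refine this.congr fun N ↦ ?_
  simp only [Function.comp]
  rw [one_div_mul_eq_div, Nat.floor_div_eq_div]

theorem tendsto_moebius_mul_sumMulModFour {a : ℕ} (ha : Odd a) (ha4 : a < 4) (d : ℕ) :
    Tendsto (fun N : ℕ ↦
        (ArithmeticFunction.moebius d : ℝ) * sumMulModFour a d (N / d) / (N : ℝ) ^ 2) atTop
      (nhds (1 / 8 * if Odd d then (ArithmeticFunction.moebius d : ℝ) / (d : ℝ) ^ 2 else 0)) := by
  split_ifs with hd
  · have h := ((tendsto_sumMulModFour_div_sq ha ha4 hd).comp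
      (Nat.tendsto_div_const_atTop hd.pos.ne')).mul ((tendsto_natDiv_div_self (d := d)).pow 2)
    have h' := h.const_mul (ArithmeticFunction.moebius d : ℝ)
    convert! h'.congr' ?_ using 2
    · ring
    filter_upwards [eventually_ge_atTop d] with N hN
    have : ((N / d : ℕ) : ℝ) ≠ 0 := by
      exact_mod_cast (Nat.div_pos hN hd.pos).ne'
    simp only [Function.comp]
    field_simp
  · simp [sumMulModFour_of_even ha (Nat.not_odd_iff_even.1 hd)]

theorem tsum_odd_moebius_div_sq :
    ∑' d : ℕ, (if Odd d then (ArithmeticFunction.moebius d : ℝ) / (d : ℝ) ^ 2 else 0) =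
      8 / π ^ 2 := by
  have h2 : 1 < (2 : ℂ).re := by norm_num
  have hmu := DirichletCharacter.LSeries.mul_mu_eq_one (1 : DirichletCharacter ℂ 2) h2
  have hL := DirichletCharacter.LFunctionTrivChar_eq_mul_riemannZeta (N := 2) (s := 2)
    (by norm_num)
  rw [DirichletCharacter.LFunctionTrivChar, DirichletCharacter.LFunction_eq_LSeries _ h2,
    riemannZeta_two, Nat.prime_two.primeFactors, prod_singleton] at hL
  have hpi : (π : ℂ) ≠ 0 := by exact_mod_cast pi_ne_zero
  rw [hL] at hmu
  have hc : LSeries ((fun n : ℕ ↦ (1 : DirichletCharacter ℂ 2) n) *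
      fun n : ℕ ↦ (ArithmeticFunction.moebius n : ℂ)) 2 = 8 / (π : ℂ) ^ 2 := by
    have e : ((2 : ℕ) : ℂ) ^ (-2 : ℂ) = 1 / 4 := by
      rw [Complex.cpow_neg]; norm_num
    rw [e] at hmu
    field_simp at hmu ⊢
    linear_combination (1 / 3 : ℂ) * hmu
  rw [← Complex.ofReal_inj, Complex.ofReal_tsum]
  push_cast
  rw [← hc, LSeries]
  refine tsum_congr fun d ↦ ?_
  rcases eq_or_ne d 0 with rfl | hd
  · simp
  rw [LSeries.term_of_ne_zero hd]
  have hcop : IsUnit (d : ZMod 2) ↔ Odd d := by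
    rw [ZMod.isUnit_iff_coprime, Nat.coprime_two_right]
  split_ifs with ho
  · simp [MulChar.one_apply (hcop.2 ho)]
  · simp [MulChar.map_nonunit _ (mt hcop.1 ho)]

theorem tendsto_sum_totient_mod_four {a : ℕ} (ha : Odd a) (ha4 : a < 4) :
    Tendsto (fun N : ℕ ↦ (∑ m ∈ Ioc 0 N with m % 4 = a, (m.totient : ℝ)) / (N : ℝ) ^ 2) atTop
      (nhds (1 / π ^ 2)) := by
  have hlim : (1 : ℝ) / π ^ 2 = ∑' d : ℕ, 1 / 8 *
      (if Odd d then (ArithmeticFunction.moebius d : ℝ) / (d : ℝ) ^ 2 else 0) := by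
    rw [tsum_mul_left, tsum_odd_moebius_div_sq]; ring
  rw [hlim]
  have hsum : Summable fun d : ℕ ↦ 1 / (d : ℝ) ^ 2 :=
    Real.summable_one_div_nat_pow.2 (by norm_num)
  refine (tendsto_tsum_of_dominated_convergence hsum
    (tendsto_moebius_mul_sumMulModFour ha ha4) ?_).congr fun N ↦ ?_
  · filter_upwards [eventually_gt_atTop 0] with N hN d
    have hN' : (0 : ℝ) < N := by exact_mod_cast hN
    rcases Nat.eq_zero_or_pos d with rfl | hd
    · simp
    have hmu : |(ArithmeticFunction.moebius d : ℝ)| ≤ 1 := by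
      exact_mod_cast ArithmeticFunction.abs_moebius_le_one
    have hS : (sumMulModFour a d (N / d) : ℝ) ≤ (N / d : ℝ) ^ 2 :=
      calc (sumMulModFour a d (N / d) : ℝ) ≤ ((N / d : ℕ) : ℝ) ^ 2 := by
            exact_mod_cast sumMulModFour_le a d (N / d)
        _ ≤ _ := by gcongr; exact Nat.cast_div_le
    rw [Real.norm_eq_abs, abs_div, abs_mul, Nat.abs_cast,
      abs_of_pos (by positivity : (0 : ℝ) < (N : ℝ) ^ 2), div_le_iff₀ (by positivity)]
    calc _ ≤ 1 * (N / d : ℝ) ^ 2 := by gcongr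
      _ = _ := by ring
  · rw [sum_totient_mod_four_eq, sum_div]
    refine tsum_eq_sum fun d hd ↦ ?_
    rcases Nat.eq_zero_or_pos d with rfl | hd0
    · simp
    · have : N / d = 0 := Nat.div_eq_of_lt (by simp at hd; lia)
      simp [this, sumMulModFour]

theorem sum_mod_four_eq_sum_four_mul_sub {R : Type*} [AddCommMonoid R] (f : ℕ → R) {b : ℕ}
    (hb : 0 < b) (hb4 : b < 4) (n : ℕ) :
    ∑ m ∈ Ioc 0 (4 * n) with m % 4 = 4 - b, f m = ∑ k ∈ Icc 1 n, f (4 * k - b) := by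
  refine sum_bij' (fun m _ ↦ m / 4 + 1) (fun k _ ↦ 4 * k - b) ?_ ?_ ?_ ?_ ?_ <;>
    simp only [mem_filter, mem_Ioc, mem_Icc] <;> intro m hm <;> first | lia | (congr 1; lia)

theorem phi_sum_4k_sub_3_and_4k_sub_1_limit :
    Tendsto (fun n : ℕ =>
        (∑ k ∈ Finset.Icc 1 n, (Nat.totient (4 * k - 3) : ℝ)) / (4 * (n : ℝ)) ^ 2)
      atTop (nhds (1 / π ^ 2)) ∧
    Tendsto (fun n : ℕ =>
        (∑ k ∈ Finset.Icc 1 n, (Nat.totient (4 * k - 1) : ℝ)) / (4 * (n : ℝ)) ^ 2)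
      atTop (nhds (1 / π ^ 2)) := by
  have h4 : Tendsto (fun n : ℕ ↦ 4 * n) atTop atTop := tendsto_id.const_mul_atTop' (by norm_num)
  constructor
  · refine ((tendsto_sum_totient_mod_four (a := 4 - 3) (by decide) (by norm_num)).comp h4).congr
      fun n ↦ ?_
    simp only [Function.comp]
    rw [sum_mod_four_eq_sum_four_mul_sub (fun m ↦ (m.totient : ℝ)) (by norm_num) (by norm_num)]
    push_cast; rfl
  · refine ((tendsto_sum_totient_mod_four (a := 4 - 1) (by decide) (by norm_num)).comp h4).congr
      fun n ↦ ?_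
    simp only [Function.comp]
    rw [sum_mod_four_eq_sum_four_mul_sub (fun m ↦ (m.totient : ℝ)) (by norm_num) (by norm_num)]
    push_cast; rfl
end

section
/- The limit as n → ∞ of (∑_{k=1}^n φ(6k − 3)) / (6n)² equals 1 / (2π²), and the limit as n → ∞ of (∑_{k=1}^n φ(6k)) / (6n)² equals 1 / (4π²). -/
open Filter Finset Real

open scoped ArithmeticFunction.Moebius

/-- The Möbius function restricted to the integers coprime to `N`. -/
def coprimeMoebius (N : ℕ) : ArithmeticFunction ℝ :=
  ⟨fun d => if d.Coprime N then (μ d : ℝ) else 0, by simp⟩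

lemma coprimeMoebius_apply (N d : ℕ) :
    coprimeMoebius N d = if d.Coprime N then (μ d : ℝ) else 0 := rfl

lemma abs_coprimeMoebius_le_one (N d : ℕ) : |coprimeMoebius N d| ≤ 1 := by
  rw [coprimeMoebius_apply]
  split_ifs
  · exact_mod_cast ArithmeticFunction.abs_moebius_le_one
  · simp

lemma coprimeMoebius_mul_id_apply (N n : ℕ) :
    (coprimeMoebius N * (ArithmeticFunction.id : ArithmeticFunction ℝ)) n =
      ∑ d ∈ n.divisors with d.Coprime N, (μ d : ℝ) * ((n : ℝ) / d) := by
  rw [ArithmeticFunction.mul_apply,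
    Nat.sum_divisorsAntidiagonal
      (fun a b => coprimeMoebius N a * (ArithmeticFunction.id : ArithmeticFunction ℝ) b),
    sum_filter]
  refine sum_congr rfl fun d hd => ?_
  have hd0 : (d : ℝ) ≠ 0 := by exact_mod_cast (Nat.pos_of_mem_divisors hd).ne'
  rw [coprimeMoebius_apply, ArithmeticFunction.natCoe_apply, ArithmeticFunction.id_apply,
    Nat.cast_div (Nat.dvd_of_mem_divisors hd) hd0, ite_mul, zero_mul]

lemma coprimeMoebius_mul_id_prime_mul {N p : ℕ} (hp : p.Prime) (hpN : p ∣ N) (n : ℕ) :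
    (coprimeMoebius N * (ArithmeticFunction.id : ArithmeticFunction ℝ)) (p * n) =
      p * (coprimeMoebius N * (ArithmeticFunction.id : ArithmeticFunction ℝ)) n := by
  have hfilter : {d ∈ (p * n).divisors | d.Coprime N} = {d ∈ n.divisors | d.Coprime N} := by
    ext d
    simp only [mem_filter, Nat.mem_divisors, mul_ne_zero_iff, hp.ne_zero, ne_eq,
      not_false_eq_true, true_and, and_congr_left_iff]
    exact fun hd _ => (hd.coprime_dvd_right hpN).dvd_mul_left
  rw [coprimeMoebius_mul_id_apply, coprimeMoebius_mul_id_apply, hfilter, mul_sum]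
  refine sum_congr rfl fun d _ => ?_
  push_cast
  ring

lemma coprimeMoebius_mul_id_of_coprime {N n : ℕ} (hn : 0 < n) (h : n.Coprime N) :
    (coprimeMoebius N * (ArithmeticFunction.id : ArithmeticFunction ℝ)) n = n.totient := by
  have key := ArithmeticFunction.sum_eq_iff_sum_mul_moebius_eq
    (f := fun k => (k.totient : ℝ)) (g := fun k => (k : ℝ))
  rw [← key.1 (fun k _ => by exact_mod_cast Nat.sum_totient k) n hn,
    ArithmeticFunction.mul_apply]
  refine sum_congr rfl fun x hx => ?_
  have hx1 : x.1.Coprime N :=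
    h.coprime_dvd_left (Dvd.intro _ (Nat.mem_divisorsAntidiagonal.1 hx).1)
  simp [coprimeMoebius_apply, hx1]

lemma totient_six_mul (n : ℕ) :
    ((6 * n).totient : ℝ) =
      2 * (coprimeMoebius 6 * (ArithmeticFunction.id : ArithmeticFunction ℝ)) n := by
  induction n using Nat.strong_induction_on with
  | _ n ih =>
    rcases Nat.eq_zero_or_pos n with rfl | hn
    · simp
    have step : ∀ p : ℕ, p.Prime → p ∣ 6 → p ∣ n → ((6 * n).totient : ℝ) =
        2 * (coprimeMoebius 6 * (ArithmeticFunction.id : ArithmeticFunction ℝ)) n := by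
      rintro p hp hp6 ⟨m, rfl⟩
      have hm : 0 < m := Nat.pos_of_mul_pos_left hn
      rw [coprimeMoebius_mul_id_prime_mul hp hp6, mul_left_comm,
        Nat.totient_mul_of_prime_of_dvd hp (hp6.mul_right m), Nat.cast_mul,
        ih m (lt_mul_left hm hp.one_lt)]
      ring
    by_cases h2 : 2 ∣ n
    · exact step 2 Nat.prime_two (by norm_num) h2
    by_cases h3 : 3 ∣ n
    · exact step 3 Nat.prime_three (by norm_num) h3
    have hcop : n.Coprime 6 :=
      Nat.Coprime.mul_right (((Nat.Prime.coprime_iff_not_dvd Nat.prime_two).2 h2).symm)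
        (((Nat.Prime.coprime_iff_not_dvd Nat.prime_three).2 h3).symm)
    rw [coprimeMoebius_mul_id_of_coprime hn hcop, Nat.totient_mul hcop.symm,
      show Nat.totient 6 = 2 by decide]
    push_cast
    rfl

lemma tsum_coprimeMoebius_six_div_sq :
    ∑' d : ℕ, coprimeMoebius 6 d / (d : ℝ) ^ 2 = 9 / π ^ 2 := by
  have hs : (1 : ℝ) < (2 : ℂ).re := by norm_num
  have hmul := DirichletCharacter.LSeries.mul_mu_eq_one (1 : DirichletCharacter ℂ 6) hs
  have hfac : Nat.primeFactors 6 = {2, 3} := by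
    rw [show 6 = 2 * 3 by norm_num, Nat.primeFactors_mul (by norm_num) (by norm_num),
      Nat.prime_two.primeFactors, Nat.prime_three.primeFactors]
    rfl
  have hL : LSeries (fun n : ℕ => (1 : DirichletCharacter ℂ 6) n) 2 = (π : ℂ) ^ 2 / 9 := by
    rw [← DirichletCharacter.LFunction_eq_LSeries _ hs]
    have h := DirichletCharacter.LFunctionTrivChar_eq_mul_riemannZeta (N := 6)
      (s := 2) (by norm_num)
    rw [DirichletCharacter.LFunctionTrivChar] at h
    rw [h, riemannZeta_two, hfac, prod_pair (by norm_num), Complex.cpow_neg, Complex.cpow_neg]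
    norm_num
    ring
  have hterm : LSeries ((fun n : ℕ => (1 : DirichletCharacter ℂ 6) n) * fun n : ℕ => (μ n : ℂ)) 2 =
      ((∑' d : ℕ, coprimeMoebius 6 d / (d : ℝ) ^ 2 : ℝ) : ℂ) := by
    rw [LSeries, Complex.ofReal_tsum]
    refine tsum_congr fun d => ?_
    rw [LSeries.term_of_ne_zero' two_ne_zero, coprimeMoebius_apply, Pi.mul_apply]
    by_cases hd : d.Coprime 6
    · rw [MulChar.one_apply ((ZMod.isUnit_iff_coprime d 6).2 hd), if_pos hd]
      simp
    · rw [MulChar.map_nonunit _ (mt (ZMod.isUnit_iff_coprime d 6).1 hd), if_neg hd]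
      simp
  rw [hL, hterm] at hmul
  norm_cast at hmul
  push_cast at hmul
  have hpi := Real.pi_ne_zero
  field_simp at hmul ⊢
  linarith

lemma sum_Ioc_id (n : ℕ) :
    ∑ m ∈ Ioc 0 n, (ArithmeticFunction.id : ArithmeticFunction ℝ) m =
      (n : ℝ) * (n + 1) / 2 := by
  induction n with
  | zero => simp
  | succ n ih =>
    rw [sum_Ioc_succ_top n.zero_le, ih, ArithmeticFunction.natCoe_apply,
      ArithmeticFunction.id_apply]
    push_cast
    ring

lemma tendsto_natDiv_div (d : ℕ) :
    Tendsto (fun n : ℕ => ((n / d : ℕ) : ℝ) / n) atTop (nhds (1 / (d : ℝ))) := by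
  have h := (tendsto_nat_floor_mul_div_atTop (R := ℝ) (a := 1 / d) (by positivity)).comp
    tendsto_natCast_atTop_atTop
  refine h.congr fun n => ?_
  simp only [Function.comp_apply]
  rw [one_div_mul_eq_div, Nat.floor_div_eq_div]

/-- If `f` is bounded by `1`, the partial sums of `f * id` are asymptotic to
`(∑ f d / d ^ 2) * n ^ 2 / 2`. -/
lemma tendsto_sum_mul_id_div_sq {f : ArithmeticFunction ℝ} (hf : ∀ d, |f d| ≤ 1) :
    Tendsto (fun n : ℕ => (∑ k ∈ Ioc 0 n,
        (f * (ArithmeticFunction.id : ArithmeticFunction ℝ)) k) / (n : ℝ) ^ 2)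
      atTop (nhds ((∑' d : ℕ, f d / (d : ℝ) ^ 2) / 2)) := by
  have hsum : ∀ n : ℕ, (∑ k ∈ Ioc 0 n,
        (f * (ArithmeticFunction.id : ArithmeticFunction ℝ)) k) / (n : ℝ) ^ 2 =
      ∑' d : ℕ, f d * (((n / d : ℕ) : ℝ) * ((n / d : ℕ) + 1) / 2) / (n : ℝ) ^ 2 := by
    intro n
    rw [ArithmeticFunction.sum_Ioc_mul_eq_sum_sum, tsum_eq_sum (s := Ioc 0 n), sum_div]
    · simp_rw [sum_Ioc_id]
    · intro d hd
      rcases Nat.eq_zero_or_pos d with rfl | hd0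
      · simp
      · rw [Nat.div_eq_of_lt (by simp only [mem_Ioc] at hd; omega)]
        simp
  simp_rw [hsum]
  rw [← tsum_div_const]
  refine tendsto_tsum_of_dominated_convergence (bound := fun d : ℕ => 1 / (d : ℝ) ^ 2)
    (Real.summable_one_div_nat_pow.2 one_lt_two) (fun d => ?_) (.of_forall fun n d => ?_)
  · have h1 := tendsto_natDiv_div d
    have h2 := ((h1.mul (h1.add tendsto_one_div_atTop_nhds_zero_nat)).const_mul (f d)).div_const 2
    convert h2 using 2 <;> ring
  · rcases Nat.eq_zero_or_pos n with rfl | hn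
    · simp
    have hn' : (0 : ℝ) < n := by exact_mod_cast hn
    have hq : ((n / d : ℕ) : ℝ) ≤ n / d := Nat.cast_div_le
    have hT : ((n / d : ℕ) : ℝ) * ((n / d : ℕ) + 1) / 2 ≤ ((n / d : ℕ) : ℝ) ^ 2 := by
      have : n / d ≤ (n / d) ^ 2 := Nat.le_self_pow two_ne_zero _
      have : ((n / d : ℕ) : ℝ) ≤ ((n / d : ℕ) : ℝ) ^ 2 := by exact_mod_cast this
      linarith
    rw [Real.norm_eq_abs, abs_div, abs_mul, abs_of_nonneg (a := (n : ℝ) ^ 2) (by positivity),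
      abs_of_nonneg (a := ((n / d : ℕ) : ℝ) * ((n / d : ℕ) + 1) / 2) (by positivity),
      div_le_iff₀ (by positivity)]
    calc |f d| * (((n / d : ℕ) : ℝ) * ((n / d : ℕ) + 1) / 2)
        ≤ 1 * ((n : ℝ) / d) ^ 2 := by
          gcongr
          · exact hf d
          · exact hT.trans (by gcongr)
      _ = 1 / (d : ℝ) ^ 2 * (n : ℝ) ^ 2 := by ring

lemma tendsto_sum_totient_six_mul_div_sq :
    Tendsto (fun n : ℕ => (∑ k ∈ Icc 1 n, ((6 * k).totient : ℝ)) / (n : ℝ) ^ 2)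
      atTop (nhds (9 / π ^ 2)) := by
  have h := (tendsto_sum_mul_id_div_sq (abs_coprimeMoebius_le_one 6)).const_mul 2
  rw [tsum_coprimeMoebius_six_div_sq, mul_div_cancel₀ _ two_ne_zero] at h
  refine h.congr fun n => ?_
  simp_rw [totient_six_mul, ← mul_sum, mul_div_assoc]
  rfl

lemma sum_totient_six_mul_sub_three (n : ℕ) :
    ∑ k ∈ Icc 1 n, ((6 * k - 3).totient : ℝ) =
      ∑ k ∈ Icc 1 (2 * n), ((6 * k).totient : ℝ) -
        2 * ∑ k ∈ Icc 1 n, ((6 * k).totient : ℝ) := by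
  induction n with
  | zero => simp
  | succ n ih =>
    have hodd : (6 * (2 * n + 1)).totient = (6 * (n + 1) - 3).totient := by
      rw [show 6 * (2 * n + 1) = 2 * (6 * (n + 1) - 3) by omega]
      exact Nat.totient_two_mul_of_odd ⟨3 * n + 1, by omega⟩
    have heven : (6 * (2 * n + 1 + 1)).totient = 2 * (6 * (n + 1)).totient := by
      rw [show 6 * (2 * n + 1 + 1) = 2 * (6 * (n + 1)) by ring]
      exact Nat.totient_mul_of_prime_of_dvd Nat.prime_two ⟨3 * (n + 1), by ring⟩
    rw [sum_Icc_succ_top (by omega), sum_Icc_succ_top (by omega), ih,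
      show 2 * (n + 1) = 2 * n + 1 + 1 by ring, sum_Icc_succ_top (by omega),
      sum_Icc_succ_top (by omega), hodd, heven]
    push_cast
    ring

theorem phi_sum_6k_sub_3_and_6k_limit :
    Tendsto (fun n : ℕ =>
        (∑ k ∈ Finset.Icc 1 n, (Nat.totient (6 * k - 3) : ℝ)) / (6 * (n : ℝ)) ^ 2)
      atTop (nhds (1 / (2 * π ^ 2))) ∧
    Tendsto (fun n : ℕ =>
        (∑ k ∈ Finset.Icc 1 n, (Nat.totient (6 * k) : ℝ)) / (6 * (n : ℝ)) ^ 2)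
      atTop (nhds (1 / (4 * π ^ 2))) := by
  have h := tendsto_sum_totient_six_mul_div_sq
  have h2 := h.comp (tendsto_id.const_mul_atTop' (two_pos : (0 : ℕ) < 2))
  constructor
  · have h3 := ((h2.const_mul 4).sub (h.const_mul 2)).div_const 36
    convert h3 using 2 with n
    · rw [sum_totient_six_mul_sub_three]
      simp only [Function.comp_apply, id_eq]
      push_cast
      ring
    · ring
  · convert h.div_const 36 using 2 <;> ring
end
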